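/- There is an absolute constant C > 0 such that for all 0 < ξ ≤ 1/4, |∫_{−∞}^{+∞} (ω_2(ξ,t) − φ_1(t)) dt − 4 + (16/3)√ξ| ≤ C·ξ, where φ_1(t) = 1/max(1,t²). -/

import Mathlib

open MeasureTheory

/-- The domain `D_2(ξ,t) ⊆ ℝ`: real numbers `p_1` with `|p_1| ≤ 1` and `|ξ t² + p_1 t| ≤ 1`. -/
def Dset2 (ξ t : ℝ) : Set ℝ := {p | |p| ≤ 1 ∧ |ξ * t ^ 2 + p * t| ≤ 1}

/-- The density function `ω_2(ξ,t)` of real quadratic algebraic integers. -/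
noncomputable def omega2 (ξ t : ℝ) : ℝ := ∫ p in Dset2 ξ t, |2 * ξ * t + p|

/-- The density function `φ_1(t) = 1 / max(1, t²)` of real rational numbers. -/
noncomputable def phi1 (t : ℝ) : ℝ := 1 / max 1 (t ^ 2)

lemma aux_J (x : ℝ) : ∫ q in (0:ℝ)..x, |q| = x * |x| / 2 := by
  rcases le_total 0 x with h | h
  · rw [intervalIntegral.integral_congr (g := fun q => q)]
    · rw [integral_id, abs_of_nonneg h]; ring
    · intro q hq
      rw [Set.uIcc_of_le h] at hq
      exact abs_of_nonneg hq.1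
  · rw [intervalIntegral.integral_congr (g := fun q => -q)]
    · rw [intervalIntegral.integral_neg, integral_id, abs_of_nonpos h]; ring
    · intro q hq
      rw [Set.uIcc_of_ge h] at hq
      exact abs_of_nonpos hq.2

lemma aux_int (c l u : ℝ) (h : l ≤ u) :
    ∫ p in Set.Icc l u, |c + p| = ((c+u) * |c+u| - (c+l) * |c+l|) / 2 := by
  rw [integral_Icc_eq_integral_Ioc, ← intervalIntegral.integral_of_le h,
    intervalIntegral.integral_comp_add_left (fun q => |q|) c,
    ← intervalIntegral.integral_interval_sub_left (a := 0) 
      (continuous_abs.intervalIntegrable _ _) (continuous_abs.intervalIntegrable _ _),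
    aux_J, aux_J]
  ring

lemma aux_bound (ξ t v M : ℝ) (hv : -1 ≤ v) (hM : ∀ p ∈ Dset2 ξ t, |2*ξ*t+p| ≤ M)
    (hD : Dset2 ξ t ⊆ Set.Icc (-1) v) (hM0 : 0 ≤ M) : |omega2 ξ t| ≤ M * (v + 1) := by
  have hfin : volume (Dset2 ξ t) < ⊤ := (measure_mono hD).trans_lt measure_Icc_lt_top
  have h1 := norm_setIntegral_le_of_norm_le_const (f := fun p => |2*ξ*t+p|) hfin
    (fun p hp => by simpa using hM p hp)
  rw [Real.norm_eq_abs] at h1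
  refine h1.trans (mul_le_mul_of_nonneg_left ?_ hM0)
  have := measureReal_mono (μ := volume) hD (by simp)
  rw [Real.volume_real_Icc_of_le hv] at this
  linarith

lemma aux_case1 (ξ t : ℝ) (hξ : 0 < ξ) (h4 : ξ ≤ 1/4) (ht : 0 < t) (h : t ≤ 1 - ξ) :
    omega2 ξ t = 1 + 4 * ξ^2 * t^2 := by
  have hD : Dset2 ξ t = Set.Icc (-1) 1 := by
    ext p
    simp only [Dset2, Set.mem_ofPred_eq, Set.mem_Icc, abs_le]
    constructor
    · rintro ⟨h1, h2⟩; exact h1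
    · rintro ⟨h1, h2⟩
      have a1 : ξ * t^2 ≤ ξ := by
        have : t^2 ≤ 1 := by nlinarith
        nlinarith
      have a2 : 0 ≤ ξ * t^2 := by positivity
      exact ⟨⟨h1, h2⟩, by nlinarith, by nlinarith⟩
  rw [omega2, hD, aux_int _ _ _ (by norm_num)]
  have : ξ * t ≤ 1/4 := by nlinarith
  have : 0 < ξ * t := by positivity
  rw [abs_of_nonneg (by linarith), abs_of_nonpos (by linarith)]
  ring

lemma aux_case3 (ξ t : ℝ) (hξ : 0 < ξ) (h4 : ξ ≤ 1/4) (h : 1 + 4 * ξ ≤ t) (h' : ξ * t ≤ 1 - 2 * ξ) :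
    omega2 ξ t = ((ξ*t+1/t) * |ξ*t+1/t| - (ξ*t-1/t) * |ξ*t-1/t|) / 2 := by
  have ht : 0 < t := by linarith
  have key : ξ * t^2 - t + 1 ≤ 0 := by
    have h1 : 0 ≤ (t - (1+4*ξ)) * (1 - 2*ξ - ξ*t) := mul_nonneg (by linarith) (by linarith)
    have h2 : 0 ≤ ξ * (1 - 4*ξ) * (t + 2) := by
      apply mul_nonneg (mul_nonneg hξ.le (by linarith)) (by linarith)
    nlinarith
  have hD : Dset2 ξ t = Set.Icc (-1/t - ξ*t) (1/t - ξ*t) := by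
    have e1 : t * (1/t) = 1 := by field_simp
    have i0 : 0 < 1/t := by positivity
    have e2 : -1/t = -(1/t) := by ring
    have k2 : ξ * t + 1/t ≤ 1 := by
      have : ξ * t + 1/t = 1 + (ξ*t^2 - t + 1)/t := by field_simp; ring
      have : (ξ*t^2 - t + 1)/t ≤ 0 := div_nonpos_of_nonpos_of_nonneg key ht.le
      linarith
    have k3 : 0 < ξ * t := by positivity
    ext p
    simp only [Dset2, Set.mem_ofPred_eq, Set.mem_Icc, abs_le, e2]
    have e3 : ξ * t^2 + p * t = t * (ξ * t + p) := by ring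
    rw [e3]
    constructor
    · rintro ⟨h1, h2, h3⟩
      constructor
      · by_contra hc
        push Not at hc
        nlinarith [mul_lt_mul_of_pos_left hc ht]
      · by_contra hc
        push Not at hc
        nlinarith [mul_lt_mul_of_pos_left hc ht]
    · rintro ⟨h1, h2⟩
      refine ⟨⟨by linarith, by linarith⟩, ?_, ?_⟩
      · nlinarith [mul_le_mul_of_nonneg_left h1 ht.le]
      · nlinarith [mul_le_mul_of_nonneg_left h2 ht.le]
  have i0 : 0 < 1/t := by positivity
  rw [omega2, hD, aux_int _ _ _ (by rw [neg_div]; linarith)]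
  have e1 : 2 * ξ * t + (1 / t - ξ * t) = ξ*t+1/t := by ring
  have e2 : 2 * ξ * t + (-1 / t - ξ * t) = ξ*t-1/t := by ring
  rw [e1, e2]

lemma aux_case2 (ξ t : ℝ) (hξ : 0 < ξ) (h4 : ξ ≤ 1/4) (ht : 0 < t) (h : t ≤ 2) :
    |omega2 ξ t| ≤ 4 := by
  have := aux_bound ξ t 1 2 (by norm_num) (fun p hp => by
      have h1 := abs_le.1 hp.1
      have : ξ * t ≤ 1/2 := by nlinarith
      have : 0 < ξ * t := by positivity
      rw [abs_le]; constructor <;> linarith)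
      (fun p hp => abs_le.1 hp.1) (by norm_num)
  linarith

lemma aux_case4 (ξ t : ℝ) (hξ : 0 < ξ) (h4 : ξ ≤ 1/4) (h : 1 - 2 * ξ ≤ ξ * t)
    (h' : ξ * t ≤ 1 + ξ) : |omega2 ξ t| ≤ 16 * ξ := by
  have h12 : 1/2 ≤ ξ * t := by linarith
  have ht : 0 < t := by
    by_contra hc
    push Not at hc
    nlinarith
  have := aux_bound ξ t (-1 + 4*ξ) 4 (by linarith) (fun p hp => by
      have h1 := abs_le.1 hp.1
      rw [abs_le]; constructor <;> linarith)
      (fun p hp => by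
        refine ⟨(abs_le.1 hp.1).1, ?_⟩
        have h2 := (abs_le.1 hp.2).2
        by_contra hc
        push Not at hc
        nlinarith [mul_lt_mul_of_pos_left hc ht]) (by norm_num)
  linarith

lemma aux_case5 (ξ t : ℝ) (hξ : 0 < ξ) (h : 1 + ξ < ξ * t) : omega2 ξ t = 0 := by
  have ht : 0 < t := by
    by_contra hc
    push Not at hc
    nlinarith
  have hD : Dset2 ξ t = ∅ := by
    ext p
    simp only [Set.mem_empty_iff_false, iff_false]
    intro hp
    have h1 := (abs_le.1 hp.1).1
    have h2 := (abs_le.1 hp.2).2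
    have : t * ξ < t * (ξ * t + p) := mul_lt_mul_of_pos_left (by linarith) ht
    nlinarith
  simp [omega2, hD]

lemma aux_even (ξ t : ℝ) : omega2 ξ (-t) = omega2 ξ t := by
  have hm : ∀ s, MeasurableSet (Dset2 ξ s) := fun s => by
    have c1 : IsClosed {p : ℝ | |p| ≤ 1} := isClosed_le (by fun_prop) (by fun_prop)
    have c2 : IsClosed {p : ℝ | |ξ * s ^ 2 + p * s| ≤ 1} := isClosed_le (by fun_prop) (by fun_prop)
    exact (c1.inter c2).measurableSet
  unfold omega2
  rw [← integral_indicator (hm _), ← integral_indicator (hm _),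
    ← integral_neg_eq_self]
  congr 1
  ext p
  have hiff : -p ∈ Dset2 ξ (-t) ↔ p ∈ Dset2 ξ t := by
    simp [Dset2]
  by_cases hp : p ∈ Dset2 ξ t
  · rw [Set.indicator_of_mem hp, Set.indicator_of_mem (hiff.2 hp), ← abs_neg]
    congr 1; ring
  · rw [Set.indicator_of_notMem hp, Set.indicator_of_notMem (fun h => hp (hiff.1 h))]

lemma aux_meas (ξ : ℝ) : StronglyMeasurable (omega2 ξ) := by
  have hm : MeasurableSet {q : ℝ × ℝ | |q.2| ≤ 1 ∧ |ξ * q.1 ^ 2 + q.2 * q.1| ≤ 1} := by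
    have c1 : IsClosed {q : ℝ × ℝ | |q.2| ≤ 1} := isClosed_le (by fun_prop) (by fun_prop)
    have c2 : IsClosed {q : ℝ × ℝ | |ξ * q.1 ^ 2 + q.2 * q.1| ≤ 1} :=
      isClosed_le (by fun_prop) (by fun_prop)
    exact (c1.inter c2).measurableSet
  have hs : ∀ s, MeasurableSet (Dset2 ξ s) := fun s => by
    have c1 : IsClosed {p : ℝ | |p| ≤ 1} := isClosed_le (by fun_prop) (by fun_prop)
    have c2 : IsClosed {p : ℝ | |ξ * s ^ 2 + p * s| ≤ 1} := isClosed_le (by fun_prop) (by fun_prop)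
    exact (c1.inter c2).measurableSet
  have hf : StronglyMeasurable (Set.indicator {q : ℝ × ℝ | |q.2| ≤ 1 ∧ |ξ * q.1 ^ 2 + q.2 * q.1| ≤ 1}
      (fun q : ℝ × ℝ => |2*ξ*q.1 + q.2|)) :=
    StronglyMeasurable.indicator (Continuous.stronglyMeasurable (by fun_prop)) hm
  have := hf.integral_prod_right' (ν := (volume : Measure ℝ))
  convert this using 1
  ext t
  rw [omega2, ← integral_indicator (hs t)]
  rfl

noncomputable def auxG (y t : ℝ) : ℝ :=
  (Set.Ioc 0 (1/y)).indicator (fun t => y^4 * t^2) t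
  + (Set.Ioc (1/y) (1/y^2)).indicator (fun _ => 2 * y^2) t
  - (Set.Ioi (1/y)).indicator (fun t => t^(-2:ℝ)) t

noncomputable def auxH (ξ t : ℝ) : ℝ :=
  (Set.Ioc 0 1).indicator (fun _ => ξ) t
  + (Set.Ioc (1 - ξ) (1 + 4 * ξ)).indicator (fun _ => 6) t
  + (Set.Ioc (1/ξ - 2) (1/ξ+1)).indicator (fun _ => 18 * ξ) t

lemma auxG_int (y : ℝ) (hy : 0 < y) (hy2 : y ≤ 1/2) :
    Integrable (auxG y) ∧ ∫ t in Set.Ioi 0, auxG y t = 2 - 8/3*y := by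
  have hle : 1/y ≤ 1/y^2 := by
    apply one_div_le_one_div_of_le (by positivity); nlinarith
  have ha : 0 < 1/y := by positivity
  have i1 : Integrable ((Set.Ioc 0 (1/y)).indicator (fun t:ℝ => y^4 * t^2)) := by
    rw [integrable_indicator_iff measurableSet_Ioc]
    exact (Continuous.integrableOn_Icc (by fun_prop)).mono_set Set.Ioc_subset_Icc_self
  have i2 : Integrable ((Set.Ioc (1/y) (1/y^2)).indicator (fun _:ℝ => 2 * y^2)) := by
    rw [integrable_indicator_iff measurableSet_Ioc]
    exact (Continuous.integrableOn_Icc (by fun_prop)).mono_set Set.Ioc_subset_Icc_self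
  have i3 : Integrable ((Set.Ioi (1/y)).indicator (fun t:ℝ => t^(-2:ℝ))) := by
    rw [integrable_indicator_iff measurableSet_Ioi]
    exact integrableOn_Ioi_rpow_of_lt (by norm_num) ha
  refine ⟨(i1.add i2).sub i3, ?_⟩
  have e : ∫ t in Set.Ioi 0, auxG y t = ∫ t, auxG y t := by
    apply setIntegral_eq_integral_of_forall_compl_eq_zero
    intro t ht
    simp only [Set.mem_Ioi, not_lt] at ht
    unfold auxG
    rw [Set.indicator_of_notMem, Set.indicator_of_notMem, Set.indicator_of_notMem]
    · ring
    · simp only [Set.mem_Ioi, not_lt]; linarith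
    · simp only [Set.mem_Ioc, not_and_or, not_lt]; left; linarith
    · simp only [Set.mem_Ioc, not_and_or, not_lt]; left; linarith
  rw [e]
  have i12 := i1.add i2
  have : ∫ t, auxG y t = (∫ t, (Set.Ioc 0 (1/y)).indicator (fun t:ℝ => y^4 * t^2) t)
      + (∫ t, (Set.Ioc (1/y) (1/y^2)).indicator (fun _:ℝ => 2 * y^2) t)
      - ∫ t, (Set.Ioi (1/y)).indicator (fun t:ℝ => t^(-2:ℝ)) t := by
    rw [← integral_add i1 i2]
    exact integral_sub i12 i3
  rw [this, integral_indicator measurableSet_Ioc, integral_indicator measurableSet_Ioc,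
    integral_indicator measurableSet_Ioi, integral_Ioi_rpow_of_lt (by norm_num) ha,
    ← intervalIntegral.integral_of_le ha.le, ← intervalIntegral.integral_of_le hle]
  rw [intervalIntegral.integral_const_mul, integral_pow, intervalIntegral.integral_const]
  have : (1/y:ℝ)^((-2:ℝ)+1) = y := by
    norm_num
    rw [Real.rpow_neg_one, inv_inv]
  rw [this, smul_eq_mul]
  have hz : y * (1/y) = 1 := by field_simp
  have hq : 1/y^2 = (1/y)^2 := by field_simp
  rw [hq]
  generalize 1/y = z at *
  have h3 : y^4 * z^3 = y := by
    have : y^4 * z^3 = y * (y*z)^3 := by ring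
    rw [this, hz]; ring
  have h4 : y^2 * z^2 = 1 := by rw [← mul_pow, hz]; ring
  have h5 : y^2 * z = y := by rw [pow_two, mul_assoc, hz, mul_one]
  norm_num
  linear_combination h3 / 3 + 2 * h4 - 2 * h5

lemma auxH_int (ξ : ℝ) (hξ : 0 < ξ) : Integrable (auxH ξ) ∧ ∫ t in Set.Ioi 0, auxH ξ t ≤ 85 * ξ := by
  have i : ∀ a b c : ℝ, Integrable ((Set.Ioc a b).indicator (fun _:ℝ => c)) := fun a b c => by
    rw [integrable_indicator_iff measurableSet_Ioc]
    exact (Continuous.integrableOn_Icc (by fun_prop)).mono_set Set.Ioc_subset_Icc_self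
  have v : ∀ a b c : ℝ, a ≤ b → ∫ t, (Set.Ioc a b).indicator (fun _:ℝ => c) t = (b - a) * c := 
    fun a b c h => by
    rw [integral_indicator measurableSet_Ioc, ← intervalIntegral.integral_of_le h,
      intervalIntegral.integral_const, smul_eq_mul]
  have hi : Integrable (auxH ξ) := ((i _ _ _).add (i _ _ _)).add (i _ _ _)
  refine ⟨hi, ?_⟩
  refine (setIntegral_le_integral hi (Filter.Eventually.of_forall fun t => ?_)).trans ?_
  · unfold auxH
    simp only [Pi.zero_apply]
    refine add_nonneg (add_nonneg ?_ ?_) ?_ <;> 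
      exact Set.indicator_nonneg (fun _ _ => by positivity) _
  have : ∫ t, auxH ξ t = (∫ t, (Set.Ioc 0 1).indicator (fun _ : ℝ => ξ) t)
      + (∫ t, (Set.Ioc (1 - ξ) (1 + 4 * ξ)).indicator (fun _ : ℝ => (6:ℝ)) t)
      + ∫ t, (Set.Ioc (1/ξ - 2) (1/ξ+1)).indicator (fun _ : ℝ => 18 * ξ) t := by
    rw [← integral_add (i _ _ _) (i _ _ _)]
    exact integral_add ((i _ _ _).add (i _ _ _)) (i _ _ _)
  rw [this, v _ _ _ (by norm_num), v _ _ _ (by linarith), v _ _ _ (by linarith)]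
  linarith

lemma phi1_one (t : ℝ) (h0 : 0 < t) (h : t ≤ 1) : phi1 t = 1 := by
  rw [phi1, max_eq_left (by nlinarith)]; norm_num

lemma phi1_big (t : ℝ) (h : 1 ≤ t) : phi1 t = t ^ (-2:ℝ) := by
  rw [phi1, max_eq_right (by nlinarith), Real.rpow_neg (by linarith)]
  norm_num

lemma auxG_small (y t : ℝ) (h0 : 0 < t) (h : t ≤ 1/y) : auxG y t = y^4 * t^2 := by
  unfold auxG
  rw [Set.indicator_of_mem (Set.mem_Ioc.2 ⟨h0, h⟩), Set.indicator_of_notMem, Set.indicator_of_notMem]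
  · ring
  · simpa using h
  · simp only [Set.mem_Ioc, not_and_or, not_lt]; left; exact h

lemma auxG_mid (y t : ℝ) (h0 : 1/y < t) (h : t ≤ 1/y^2) : auxG y t = 2 * y^2 - t^(-2:ℝ) := by
  unfold auxG
  rw [Set.indicator_of_notMem, Set.indicator_of_mem (Set.mem_Ioc.2 ⟨h0, h⟩), Set.indicator_of_mem (Set.mem_Ioi.2 h0)]
  · ring
  · simp only [Set.mem_Ioc, not_and_or, not_le]; right; exact h0

lemma auxG_big (y t : ℝ) (h0 : 1/y < t) (h : 1/y^2 < t) : auxG y t = - t^(-2:ℝ) := by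
  unfold auxG
  rw [Set.indicator_of_notMem, Set.indicator_of_notMem, Set.indicator_of_mem (Set.mem_Ioi.2 h0)]
  · ring
  · simp only [Set.mem_Ioc, not_and_or, not_le]; right; exact h
  · simp only [Set.mem_Ioc, not_and_or, not_le]; right; exact h0

lemma aux_main (y t : ℝ) (hy : 0 < y) (hy2 : y ≤ 1/2) (ht : 0 < t) :
    |omega2 (y^2) t - phi1 t - auxG y t| ≤ auxH (y^2) t := by
  have hξ : 0 < y^2 := by positivity
  have h4 : y^2 ≤ 1/4 := by nlinarith
  have hi : ∀ (a b c : ℝ), 0 ≤ c → 0 ≤ (Set.Ioc a b).indicator (fun _ : ℝ => c) t := 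
    fun a b c hc => Set.indicator_nonneg (fun _ _ => hc) _
  have H1 := hi 0 1 (y^2) hξ.le
  have H2 := hi (1-y^2) (1+4*y^2) 6 (by norm_num)
  have H3 := hi (1/y^2-2) (1/y^2+1) (18*y^2) (by positivity)
  have hy2' : 2 ≤ 1/y := by rw [le_div_iff₀ hy]; linarith
  have hsq : 1/y^2 = (1/y)^2 := by field_simp
  have hab : 1/y ≤ 1/y^2 - 2 := by rw [hsq]; nlinarith
  have hm : y^2 * (1/y^2) = 1 := by field_simp
  rcases le_or_gt t (1 - y^2) with c1 | c1
  · rw [aux_case1 _ _ hξ h4 ht c1, phi1_one t ht (by linarith), auxG_small y t ht (by linarith)]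
    have : auxH (y^2) t ≥ y^2 := by
      unfold auxH
      have : (Set.Ioc 0 1).indicator (fun _ : ℝ => y^2) t = y^2 := 
        Set.indicator_of_mem (show t ∈ Set.Ioc (0:ℝ) 1 from ⟨ht, by linarith⟩) _
      linarith
    refine le_trans ?_ this
    have e : 1 + 4 * (y^2)^2 * t^2 - 1 - y^4*t^2 = y^2 * (3 * y^2 * t^2) := by ring
    rw [e, abs_of_nonneg (by positivity)]
    have : t^2 ≤ 1 := by nlinarith
    have : 3 * y^2 * t^2 ≤ 1 := by nlinarith
    nlinarith
  rcases le_or_gt t (1 + 4 * y^2) with c2 | c2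
  · have : auxH (y^2) t ≥ 6 := by
      unfold auxH
      have : (Set.Ioc (1-y^2) (1+4*y^2)).indicator (fun _ : ℝ => (6:ℝ)) t = 6 := 
        Set.indicator_of_mem (show t ∈ Set.Ioc (1-y^2) (1+4*y^2) from ⟨c1, c2⟩) _
      linarith
    refine le_trans ?_ this
    rw [auxG_small y t ht (by linarith)]
    have b1 := abs_le.1 (aux_case2 (y^2) t hξ h4 ht (by linarith))
    have b2 : phi1 t ≤ 1 := by
      unfold phi1
      rw [div_le_one (by positivity)]; exact le_max_left _ _
    have b3 : 0 ≤ phi1 t := by unfold phi1; positivity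
    have b4 : 0 ≤ y^4 * t^2 := by positivity
    have b5 : y^4 * t^2 ≤ 1 := by
      have : y^2 * t ≤ 1 := by nlinarith
      have h0 : 0 ≤ y^2 * t := by positivity
      have : y^4*t^2 = (y^2*t)^2 := by ring
      rw [this]; nlinarith
    rw [abs_le]; constructor <;> linarith
  have hphi := phi1_big t (by linarith)
  rcases le_or_gt t (1/y^2 - 2) with c3 | c3
  · have hw := aux_case3 (y^2) t hξ h4 c2.le (by nlinarith)
    have : omega2 (y^2) t - phi1 t - auxG y t = 0 := by
      have i0 : 0 < 1/t := by positivity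
      have i1 : 0 < y^2 * t := by positivity
      have hp : t^(-2:ℝ) = (1/t)^2 := by 
        rw [Real.rpow_neg ht.le]; norm_num
      have ee : t * (1/t) = 1 := by field_simp
      rcases le_or_gt t (1/y) with d | d
      · rw [hw, hphi, auxG_small y t ht d, hp]
        have : y^2 * t ≤ 1/t := by
          rw [le_div_iff₀ ht]
          rw [le_div_iff₀ hy] at d
          have : 0 < t*y := by positivity
          nlinarith
        rw [abs_of_pos (by positivity), abs_of_nonpos (by linarith)]
        ring
      · rw [hw, hphi, auxG_mid y t d (by linarith), hp]
        have : 1/t ≤ y^2 * t := by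
          rw [div_le_iff₀ ht]
          rw [div_lt_iff₀ hy] at d
          nlinarith
        rw [abs_of_pos (by positivity), abs_of_nonneg (by linarith)]
        linear_combination (2*y^2) * ee
    rw [this, abs_zero]
    unfold auxH
    linarith
  rcases le_or_gt t (1/y^2 + 1) with c4 | c4
  · have : auxH (y^2) t ≥ 18 * y^2 := by
      unfold auxH
      have : (Set.Ioc (1/y^2-2) (1/y^2+1)).indicator (fun _ : ℝ => 18*y^2) t = 18*y^2 := 
        Set.indicator_of_mem (show t ∈ Set.Ioc (1/y^2-2) (1/y^2+1) from ⟨c3, c4⟩) _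
      linarith
    refine le_trans ?_ this
    have b1 := abs_le.1 (aux_case4 (y^2) t hξ h4 (by nlinarith) (by nlinarith))
    rcases le_or_gt t (1/y^2) with d | d
    · rw [hphi, auxG_mid y t (by linarith) d, abs_le]; constructor <;> linarith
    · rw [hphi, auxG_big y t (by linarith) d, abs_le]; constructor <;> linarith
  · rw [aux_case5 (y^2) t hξ (by nlinarith), hphi, auxG_big y t (by linarith) (by linarith)]
    have : (0 - t^(-2:ℝ) - -t^(-2:ℝ)) = 0 := by ring
    rw [this, abs_zero]
    unfold auxH
    linarith

theorem integral_omega2_sub_phi1 :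
    ∃ C : ℝ, 0 < C ∧ ∀ ξ : ℝ, 0 < ξ → ξ ≤ 1 / 4 →
      |(∫ t : ℝ, (omega2 ξ t - phi1 t)) - 4 + (16 / 3) * Real.sqrt ξ| ≤ C * ξ := by
  refine ⟨170, by norm_num, fun ξ hξ h4 => ?_⟩
  obtain ⟨y, hy, rfl⟩ : ∃ y : ℝ, 0 < y ∧ ξ = y^2 :=
    ⟨Real.sqrt ξ, Real.sqrt_pos.2 hξ, (Real.sq_sqrt hξ.le).symm⟩
  have hy2 : y ≤ 1/2 := by nlinarith
  rw [Real.sqrt_sq hy.le]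
  have hev : ∫ t : ℝ, (omega2 (y^2) t - phi1 t) = 2 * ∫ t in Set.Ioi 0, (omega2 (y^2) t - phi1 t) := by
    rw [← integral_comp_abs (f := fun t => omega2 (y^2) t - phi1 t)]
    congr 1
    ext t
    rcases abs_choice t with h | h
    · rw [h]
    · rw [h, aux_even]; simp [phi1]
  obtain ⟨gI, gV⟩ := auxG_int y hy hy2
  obtain ⟨hI, hV⟩ := auxH_int (y^2) hξ
  have hb : ∀ᵐ t ∂(volume.restrict (Set.Ioi (0:ℝ))),
      ‖omega2 (y^2) t - phi1 t - auxG y t‖ ≤ auxH (y^2) t :=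
    (ae_restrict_iff' measurableSet_Ioi).2 (Filter.Eventually.of_forall fun t ht =>
      aux_main y t hy hy2 ht)
  have hphim : Measurable phi1 := by unfold phi1; fun_prop
  have dI : IntegrableOn (fun t => omega2 (y^2) t - phi1 t - auxG y t) (Set.Ioi 0) := by
    refine Integrable.mono' hI.integrableOn ?_ hb
    exact (((aux_meas _).aestronglyMeasurable.sub hphim.aestronglyMeasurable).sub
      gI.aestronglyMeasurable).restrict
  have hd := norm_integral_le_of_norm_le hI.integrableOn hb
  have hs : ∫ t in Set.Ioi 0, (omega2 (y^2) t - phi1 t) =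
      (∫ t in Set.Ioi 0, (omega2 (y^2) t - phi1 t - auxG y t)) + ∫ t in Set.Ioi 0, auxG y t := by
    rw [← integral_add dI gI.integrableOn]
    congr 1
    ext t
    ring
  rw [hev, hs, gV]
  rw [Real.norm_eq_abs] at hd
  have := abs_le.1 (hd.trans hV)
  rw [abs_le]
  constructor <;> linarith
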